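/- Let K ⊆ ℝ² be a convex body with nonempty interior which is not a Euclidean disc (i.e., K is not a closed ball). Let A = vol(K), let L ∈ ℝ satisfy vol(K + tB) = A + L·t + π·t² for all t ≥ 0, and let R_e = inf{ r ≥ 0 : there exists x with K contained in the closed ball of center x and radius r } be the circumradius (outradius) of K. Then A − L·R_e + π·R_e² < 0; that is, the Steiner polynomial evaluated at −R_e is strictly negative, so −R_e lies strictly between the two real roots t₁ < t₂ of S_K, giving t₁ < −R_e. -/

import Mathlib

open MeasureTheory Metric Pointwise

/-- One-dimensional Brunn–Minkowski inequality for compact sets. -/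
theorem volume_add_le_volume_add_set {s t : Set ℝ} (hs : IsCompact s) (ht : IsCompact t)
    (hs0 : s.Nonempty) (ht0 : t.Nonempty) :
    volume s + volume t ≤ volume (s + t) := by
  obtain ⟨a, has, ha⟩ := hs.exists_isGreatest hs0
  obtain ⟨b, hbt, hb⟩ := ht.exists_isLeast ht0
  have hdisj : AEDisjoint volume (b +ᵥ s) (a +ᵥ t) := by
    refine measure_mono_null (t := {a + b}) ?_ (by simp)
    rintro _ ⟨⟨x, hx, rfl⟩, ⟨y, hy, h⟩⟩
    have := ha hx
    have := hb hy
    simp only [vadd_eq_add, Set.mem_singleton_iff] at h ⊢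
    linarith
  have h2 : MeasurableSet (a +ᵥ t) := (ht.vadd a).measurableSet
  calc volume s + volume t = volume (b +ᵥ s) + volume (a +ᵥ t) := by simp
    _ = volume ((b +ᵥ s) ∪ (a +ᵥ t)) :=
        (measure_union₀ h2.nullMeasurableSet hdisj).symm
    _ ≤ volume (s + t) := by
        refine measure_mono (Set.union_subset ?_ ?_)
        · rintro _ ⟨x, hx, rfl⟩
          exact ⟨x, hx, b, hbt, add_comm _ _⟩
        · rintro _ ⟨y, hy, rfl⟩
          exact ⟨a, has, y, hy, rfl⟩

/-- The part of the Minkowski sum of two planar sets formed from pairs of points with a common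
first coordinate. -/
def fiberSum (s t : Set (ℝ × ℝ)) : Set (ℝ × ℝ) :=
  (fun z : (ℝ × ℝ) × (ℝ × ℝ) => z.1 + z.2) '' (s ×ˢ t ∩ {z | z.1.1 = z.2.1})

theorem mem_fiberSum {s t : Set (ℝ × ℝ)} {z : ℝ × ℝ} :
    z ∈ fiberSum s t ↔ ∃ x ∈ s, ∃ y ∈ t, x.1 = y.1 ∧ x + y = z := by
  constructor
  · rintro ⟨⟨x, y⟩, ⟨⟨hx, hy⟩, h⟩, rfl⟩
    exact ⟨x, hx, y, hy, h, rfl⟩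
  · rintro ⟨x, hx, y, hy, h, rfl⟩
    exact ⟨⟨x, y⟩, ⟨⟨hx, hy⟩, h⟩, rfl⟩

theorem fiberSum_subset_add (s t : Set (ℝ × ℝ)) : fiberSum s t ⊆ s + t := by
  intro z hz
  obtain ⟨x, hx, y, hy, -, rfl⟩ := mem_fiberSum.1 hz
  exact Set.add_mem_add hx hy

theorem isCompact_fiberSum {s t : Set (ℝ × ℝ)} (hs : IsCompact s) (ht : IsCompact t) :
    IsCompact (fiberSum s t) := by
  refine ((hs.prod ht).inter_right ?_).image (by fun_prop)
  exact isClosed_eq (by fun_prop) (by fun_prop)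

theorem IsCompact.preimage_prodMk {s : Set (ℝ × ℝ)} (hs : IsCompact s) (x : ℝ) :
    IsCompact (Prod.mk x ⁻¹' s) :=
  (Topology.IsClosedEmbedding.of_continuous_injective_isClosedMap (by fun_prop)
    (Prod.mk_right_injective x) (isClosedMap_prodMk_left x)).isCompact_preimage hs

theorem two_mul_volume_add_le_volume_fiberSum {s t : Set (ℝ × ℝ)}
    (hs : IsCompact s) (ht : IsCompact t)
    (hst : ∀ x, (Prod.mk x ⁻¹' s).Nonempty ↔ (Prod.mk x ⁻¹' t).Nonempty) :
    2 * (volume s + volume t) ≤ volume (fiberSum s t) := by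
  have hms := hs.measurableSet
  have hmt := ht.measurableSet
  have hmW := (isCompact_fiberSum hs ht).measurableSet
  have hfib : ∀ x : ℝ, volume (Prod.mk x ⁻¹' s) + volume (Prod.mk x ⁻¹' t)
      ≤ volume (Prod.mk (2 * x) ⁻¹' fiberSum s t) := by
    intro x
    by_cases hx : (Prod.mk x ⁻¹' s).Nonempty
    · refine (volume_add_le_volume_add_set (hs.preimage_prodMk x) (ht.preimage_prodMk x) hx
        ((hst x).1 hx)).trans (measure_mono ?_)
      rintro _ ⟨y, hy, z, hz, rfl⟩
      refine mem_fiberSum.2 ⟨(x, y), hy, (x, z), hz, rfl, ?_⟩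
      simp [two_mul]
    · have hx' := (hst x).not.1 hx
      rw [Set.not_nonempty_iff_eq_empty] at hx hx'
      simp [hx, hx']
  have hmeas : Measurable fun x : ℝ => volume (Prod.mk x ⁻¹' fiberSum s t) :=
    measurable_measure_prodMk_left hmW
  have hscale : ∫⁻ x : ℝ, volume (Prod.mk x ⁻¹' fiberSum s t)
      = 2 * ∫⁻ x : ℝ, volume (Prod.mk (2 * x) ⁻¹' fiberSum s t) := by
    have h := lintegral_smul_measure (μ := Measure.map (fun x : ℝ => 2 * x) volume)
      (ENNReal.ofReal |2|) fun x : ℝ => volume (Prod.mk x ⁻¹' fiberSum s t)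
    rw [Real.smul_map_volume_mul_left two_ne_zero, lintegral_map hmeas (by fun_prop)] at h
    simpa using h
  rw [Measure.volume_eq_prod, Measure.prod_apply hms, Measure.prod_apply hmt,
    Measure.prod_apply hmW, hscale,
    ← lintegral_add_left (measurable_measure_prodMk_left hms)]
  gcongr
  exact hfib _

theorem one_sub_cos_le (x : ℝ) : 1 - Real.cos x ≤ x ^ 2 / 2 := by
  linarith [Real.one_sub_sq_div_two_le_cos (x := x)]

/-- A nonnegative function on `(-α, α)` whose increments, weighted by the cosine, are controlled by
`1 - cos` vanishes if it also vanishes at the right end in the same sense. -/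
theorem eq_zero_of_sub_mul_cos_le {f : ℝ → ℝ} {r α : ℝ} (hr : 0 ≤ r) (hα : 0 < α)
    (hα' : α ≤ Real.pi / 2) (hf0 : ∀ x ∈ Set.Ioo (-α) α, 0 ≤ f x)
    (hf : ∀ x ∈ Set.Ioo (-α) α, ∀ y ∈ Set.Ioo (-α) α,
      (f x - f y) * Real.cos x ≤ r * (1 - Real.cos (x - y)))
    (hfα : ∀ x ∈ Set.Ioo (-α) α, f x * Real.cos x ≤ r * (1 - Real.cos (α - x)))
    {x : ℝ} (hx : x ∈ Set.Ioo (-α) α) : f x = 0 := by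
  have hderiv : ∀ y ∈ Set.Ioo (-α) α, HasDerivAt f 0 y := by
    intro y hy
    have hcy : 0 < Real.cos y := Real.cos_pos_of_mem_Ioo ⟨by linarith [hy.1], by linarith [hy.2]⟩
    have hev : ∀ᶠ z in nhds y, Real.cos y / 2 < Real.cos z :=
      Real.continuous_cos.continuousAt.eventually_const_lt (by linarith)
    have hbound : (fun z => f z - f y) =O[nhds y] fun z => (z - y) ^ 2 := by
      refine Asymptotics.IsBigO.of_bound (r / Real.cos y) ?_
      filter_upwards [hev, isOpen_Ioo.mem_nhds hy] with z hz hz'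
      have h1 := hf z hz' y hy
      have h2 := hf y hy z hz'
      have h3 : r * (1 - Real.cos (z - y)) ≤ r * ((z - y) ^ 2 / 2) :=
        mul_le_mul_of_nonneg_left (one_sub_cos_le _) hr
      rw [← Real.cos_neg (y - z), neg_sub] at h2
      rw [Real.norm_eq_abs, Real.norm_eq_abs, abs_of_nonneg (sq_nonneg (z - y)), div_mul_eq_mul_div,
        le_div_iff₀ hcy]
      rcases abs_cases (f z - f y) with ⟨h, h'⟩ | ⟨h, h'⟩ <;> rw [h]
      · nlinarith
      · have h4 : 0 ≤ r * (z - y) ^ 2 := by positivity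
        linarith
    have hlittle : (fun z => (z - y) ^ 2) =o[nhds y] fun z => z - y := by
      refine Asymptotics.IsLittleO.of_bound fun ε hε => ?_
      filter_upwards [Metric.ball_mem_nhds y hε] with z hz
      rw [Metric.mem_ball, Real.dist_eq] at hz
      rw [norm_pow, pow_two]
      exact mul_le_mul_of_nonneg_right hz.le (norm_nonneg _)
    rw [hasDerivAt_iff_isLittleO]
    simpa using hbound.trans_isLittleO hlittle
  have hconst : ∀ y ∈ Set.Ioo (-α) α, f x = f y := fun y hy =>
    isOpen_Ioo.is_const_of_deriv_eq_zero isPreconnected_Ioo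
      (fun z hz => (hderiv z hz).differentiableAt.differentiableWithinAt)
      (fun z hz => (hderiv z hz).deriv) hx hy
  refine le_antisymm ?_ (hf0 x hx)
  have hle : ∀ δ ∈ Set.Ioo 0 α, f x ≤ Real.pi * r / 4 * δ := by
    intro δ hδ
    have hy : α - δ ∈ Set.Ioo (-α) α := ⟨by linarith [hδ.2], by linarith [hδ.1]⟩
    have h1 := hfα _ hy
    rw [← hconst _ hy, sub_sub_cancel] at h1
    have h2 : 2 / Real.pi * δ ≤ Real.sin δ := Real.mul_le_sin hδ.1.le (by linarith [hδ.2])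
    have h3 : Real.sin δ ≤ Real.cos (α - δ) := by
      rw [← Real.cos_pi_div_two_sub]
      exact Real.cos_le_cos_of_nonneg_of_le_pi (by linarith [hδ.2])
        (by linarith [hδ.1, Real.pi_pos]) (by linarith)
    have h4 := mul_le_mul_of_nonneg_left (one_sub_cos_le δ) hr
    have h5 := mul_le_mul_of_nonneg_left (h2.trans h3) (hf0 x hx)
    have h6 : f x * (2 / Real.pi) * δ ≤ r * δ / 2 * δ := by nlinarith
    have h7 := le_of_mul_le_mul_right h6 hδ.1
    rw [mul_div_assoc', div_le_iff₀ Real.pi_pos] at h7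
    linarith
  have ht : Filter.Tendsto (fun δ => Real.pi * r / 4 * δ) (nhdsWithin 0 (Set.Ioi 0)) (nhds 0) := by
    have : Filter.Tendsto (fun δ => Real.pi * r / 4 * δ) (nhds 0) (nhds (Real.pi * r / 4 * 0)) :=
      (continuous_const.mul continuous_id).tendsto 0
    rw [mul_zero] at this
    exact this.mono_left nhdsWithin_le_nhds
  refine ge_of_tendsto ht ?_
  filter_upwards [Ioo_mem_nhdsGT hα] with δ hδ using hle δ hδ

/-- The part of the disc of radius `√(1 + c ^ 2)` lying in the cone spanned by the points
`(-1, c)` and `(1, c)` (in the upper half-plane if `c = 0`). -/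
def diskSector (c : ℝ) : Set (ℝ × ℝ) :=
  {z | z.1 ^ 2 + z.2 ^ 2 ≤ 1 + c ^ 2 ∧ c * |z.1| ≤ z.2}

theorem abs_fst_le_one_of_mem_diskSector {c : ℝ} (hc : 0 ≤ c) {z : ℝ × ℝ}
    (hz : z ∈ diskSector c) : |z.1| ≤ 1 := by
  obtain ⟨h1, h2⟩ := hz
  have h3 : (c * |z.1|) ^ 2 ≤ z.2 ^ 2 := pow_le_pow_left₀ (by positivity) h2 2
  rw [mul_pow, sq_abs] at h3
  rw [← sq_le_one_iff_abs_le_one]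
  nlinarith [sq_nonneg c]

theorem isCompact_diskSector (c : ℝ) : IsCompact (diskSector c) := by
  have hcl : IsClosed (diskSector c) := by
    refine IsClosed.inter (s₁ := {z : ℝ × ℝ | z.1 ^ 2 + z.2 ^ 2 ≤ 1 + c ^ 2})
      (s₂ := {z : ℝ × ℝ | c * |z.1| ≤ z.2})
      (isClosed_le ?_ ?_) (isClosed_le ?_ ?_) <;> fun_prop
  refine Metric.isCompact_of_isClosed_isBounded hcl
    ((Metric.isBounded_closedBall (x := (0 : ℝ × ℝ)) (r := 1 + c ^ 2)).subset ?_)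
  rintro ⟨x, y⟩ ⟨h, -⟩
  simp only at h
  rw [mem_closedBall_zero_iff, Prod.norm_def, Real.norm_eq_abs, Real.norm_eq_abs]
  refine max_le (abs_le_of_sq_le_sq ?_ (by positivity)) (abs_le_of_sq_le_sq ?_ (by positivity)) <;>
    nlinarith [sq_nonneg c, sq_nonneg x, sq_nonneg y, sq_nonneg (c ^ 2)]

theorem convex_diskSector {c : ℝ} (hc : 0 ≤ c) : Convex ℝ (diskSector c) := by
  rintro ⟨x, y⟩ ⟨h1, h2⟩ ⟨x', y'⟩ ⟨h1', h2'⟩ a b ha hb hab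
  simp only at h1 h2 h1' h2'
  refine ⟨?_, ?_⟩
  · simp only [Prod.smul_mk, Prod.mk_add_mk, smul_eq_mul]
    obtain rfl : b = 1 - a := by linarith
    nlinarith [mul_nonneg (mul_nonneg ha hb) (sq_nonneg (x - x')),
      mul_nonneg (mul_nonneg ha hb) (sq_nonneg (y - y')), mul_le_mul_of_nonneg_left h1 ha,
      mul_le_mul_of_nonneg_left h1' hb]
  · simp only [Prod.smul_mk, Prod.mk_add_mk, smul_eq_mul]
    have h3 : |a * x + b * x'| ≤ a * |x| + b * |x'| := by
      refine (abs_add_le _ _).trans ?_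
      rw [abs_mul, abs_mul, abs_of_nonneg ha, abs_of_nonneg hb]
    nlinarith [mul_le_mul_of_nonneg_left h3 hc, mul_le_mul_of_nonneg_left h2 ha,
      mul_le_mul_of_nonneg_left h2' hb]

theorem interior_diskSector_nonempty {c : ℝ} : (interior (diskSector c)).Nonempty := by
  have hopen : IsOpen {z : ℝ × ℝ | z.1 ^ 2 + z.2 ^ 2 < 1 + c ^ 2 ∧ c * |z.1| < z.2} := by
    refine IsOpen.inter (s := {z : ℝ × ℝ | z.1 ^ 2 + z.2 ^ 2 < 1 + c ^ 2})
      (t := {z : ℝ × ℝ | c * |z.1| < z.2})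
      (isOpen_lt ?_ ?_) (isOpen_lt ?_ ?_) <;> fun_prop
  have hsub : {z : ℝ × ℝ | z.1 ^ 2 + z.2 ^ 2 < 1 + c ^ 2 ∧ c * |z.1| < z.2} ⊆ diskSector c :=
    fun z hz => ⟨hz.1.le, hz.2.le⟩
  refine ⟨(0, 1 / 2), interior_maximal hsub hopen ?_⟩
  constructor <;> norm_num
  nlinarith [sq_nonneg c]

theorem two_mul_volume_add_le_volume_fiberSum_diskSector {c : ℝ} (hc : 0 ≤ c) {s : Set (ℝ × ℝ)}
    (hs : IsCompact s) (hsc : Convex ℝ s) (hsD : s ⊆ diskSector c)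
    (hl : (-1, c) ∈ s) (hr : (1, c) ∈ s) :
    2 * (volume s + volume (diskSector c)) ≤ volume (fiberSum s (diskSector c)) := by
  refine two_mul_volume_add_le_volume_fiberSum hs (isCompact_diskSector c) fun x =>
    ⟨fun ⟨y, hy⟩ => ⟨y, hsD hy⟩, fun ⟨y, hy⟩ => ⟨c, ?_⟩⟩
  have hx := abs_le.1 (abs_fst_le_one_of_mem_diskSector hc hy)
  have h := hsc hl hr (a := (1 - x) / 2) (b := (1 + x) / 2) (by linarith [hx.2])
    (by linarith [hx.1]) (by ring)
  have heq : ((1 - x) / 2) • (-1, c) + ((1 + x) / 2) • (1, c) = (x, c) := by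
    simp only [Prod.smul_mk, Prod.mk_add_mk, smul_eq_mul, Prod.mk.injEq]
    constructor <;> ring
  rwa [heq] at h

theorem add_diskSector_subset_fiberSum {c : ℝ} (hc : 0 ≤ c) {s : Set (ℝ × ℝ)}
    (hs : IsCompact s) (hsc : Convex ℝ s) (hsD : s ⊆ diskSector c)
    (hl : (-1, c) ∈ s) (hr : (1, c) ∈ s)
    (h : volume (s + diskSector c) ≤ 2 * (volume s + volume (diskSector c))) :
    s + diskSector c ⊆ fiberSum s (diskSector c) := by
  have hF := isCompact_fiberSum hs (isCompact_diskSector c)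
  have hnull : volume ((s + diskSector c) \ fiberSum s (diskSector c)) = 0 := by
    rw [measure_sdiff (fiberSum_subset_add _ _) hF.measurableSet.nullMeasurableSet
      hF.measure_lt_top.ne]
    exact tsub_eq_zero_of_le
      (h.trans (two_mul_volume_add_le_volume_fiberSum_diskSector hc hs hsc hsD hl hr))
  have hempty : interior (s + diskSector c) \ fiberSum s (diskSector c) = ∅ :=
    ((isOpen_interior.sdiff hF.isClosed).measure_eq_zero_iff volume).1
      (measure_mono_null (Set.sdiff_subset_sdiff_left interior_subset) hnull)
  have hint : (interior (s + diskSector c)).Nonempty := by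
    obtain ⟨x, hx⟩ := interior_diskSector_nonempty (c := c)
    exact ⟨_, subset_interior_add_right (Set.add_mem_add hl hx)⟩
  calc s + diskSector c ⊆ closure (s + diskSector c) := subset_closure
    _ = closure (interior (s + diskSector c)) :=
      ((hsc.add (convex_diskSector hc)).closure_interior_eq_closure_of_nonempty_interior hint).symm
    _ ⊆ fiberSum s (diskSector c) :=
      closure_minimal (Set.sdiff_eq_empty.1 hempty) hF.isClosed

/-- If the Minkowski sum of a compact subset `s` of a disc sector with the sector consists of
fibrewise sums only, then `s` contains the circular arc bounding the sector. -/
theorem mem_of_add_diskSector_subset_fiberSum {c : ℝ} (hc : 0 ≤ c) {s : Set (ℝ × ℝ)}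
    (hs : IsCompact s) (hsD : s ⊆ diskSector c) (hl : (-1, c) ∈ s) (hr : (1, c) ∈ s)
    (h : s + diskSector c ⊆ fiberSum s (diskSector c)) {z : ℝ × ℝ}
    (hz : z.1 ^ 2 + z.2 ^ 2 = 1 + c ^ 2) (hzc : c * |z.1| ≤ z.2) : z ∈ s := by
  obtain ⟨r, hr0, hr2⟩ : ∃ r : ℝ, 0 < r ∧ r ^ 2 = 1 + c ^ 2 :=
    ⟨√(1 + c ^ 2), by positivity, Real.sq_sqrt (by positivity)⟩
  have hcr : c < r := lt_of_pow_lt_pow_left₀ 2 hr0.le (by linarith)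
  obtain ⟨α, hα0, hα, hcos, hsin⟩ :
      ∃ α : ℝ, 0 < α ∧ α ≤ Real.pi / 2 ∧ r * Real.cos α = c ∧ r * Real.sin α = 1 := by
    refine ⟨Real.arccos (c / r), Real.arccos_pos.2 ((div_lt_one hr0).2 hcr),
      Real.arccos_le_pi_div_two.2 (by positivity), ?_, ?_⟩
    · rw [Real.cos_arccos (by linarith [div_nonneg hc hr0.le]) ((div_lt_one hr0).2 hcr).le]
      field_simp
    · have h0 : 0 ≤ Real.sin (Real.arccos (c / r)) :=
        Real.sin_nonneg_of_nonneg_of_le_pi (Real.arccos_nonneg _) (Real.arccos_le_pi _)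
      have h1 : Real.cos (Real.arccos (c / r)) = c / r :=
        Real.cos_arccos (by linarith [div_nonneg hc hr0.le]) ((div_lt_one hr0).2 hcr).le
      have h2 := Real.sin_sq_add_cos_sq (Real.arccos (c / r))
      rw [h1, div_pow, hr2] at h2
      have h3 : (r * Real.sin (Real.arccos (c / r))) ^ 2 = 1 ^ 2 := by
        rw [mul_pow, hr2]
        field_simp at h2
        linarith
      exact (pow_left_inj₀ (by positivity) zero_le_one two_ne_zero).1 h3
  have hcospos : ∀ θ ∈ Set.Ioo (-α) α, 0 < Real.cos θ := fun θ hθ =>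
    Real.cos_pos_of_mem_Ioo ⟨by linarith [hθ.1], by linarith [hθ.2]⟩
  have hkey : ∀ θ ∈ Set.Ioo (-α) α, ∃ k : ℝ, (r * Real.sin θ, k) ∈ s ∧
      ∀ w ∈ s, w.1 * Real.sin θ + w.2 * Real.cos θ ≤ r * Real.sin θ ^ 2 + k * Real.cos θ := by
    intro θ hθ
    have hsc := Real.sin_sq_add_cos_sq θ
    have hmem : (r * Real.sin θ, r * Real.cos θ) ∈ diskSector c := by
      refine ⟨?_, ?_⟩
      · simp only
        nlinarith
      · have h1 : 0 ≤ Real.sin (α - θ) := Real.sin_nonneg_of_nonneg_of_le_pi (by linarith [hθ.2])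
          (by linarith [hθ.1])
        have h2 : 0 ≤ Real.sin (α + θ) := Real.sin_nonneg_of_nonneg_of_le_pi (by linarith [hθ.1])
          (by linarith [hθ.2])
        rw [Real.sin_sub] at h1
        rw [Real.sin_add] at h2
        simp only [abs_mul, abs_of_pos hr0]
        have h3 := mul_nonneg hr0.le h1
        have h4 := mul_nonneg hr0.le h2
        have h5 : c * |Real.sin θ| ≤ Real.cos θ := by
          rcases abs_cases (Real.sin θ) with ⟨h, -⟩ | ⟨h, -⟩ <;> rw [h, ← hcos]
          · linear_combination h3 + Real.cos θ * hsin
          · linear_combination h4 + Real.cos θ * hsin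
        nlinarith
    obtain ⟨x, hx, hmax⟩ := hs.exists_isMaxOn ⟨_, hl⟩
      (f := fun w : ℝ × ℝ => w.1 * Real.sin θ + w.2 * Real.cos θ) (by fun_prop)
    obtain ⟨k, hk, b, hb, hkb, hsum⟩ := mem_fiberSum.1 (h (Set.add_mem_add hx hmem))
    have h1 : k.1 + b.1 = x.1 + r * Real.sin θ := congrArg Prod.fst hsum
    have h2 : k.2 + b.2 = x.2 + r * Real.cos θ := congrArg Prod.snd hsum
    have h3 : k.1 * Real.sin θ + k.2 * Real.cos θ ≤ x.1 * Real.sin θ + x.2 * Real.cos θ :=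
      hmax hk
    have h4 : r ≤ b.1 * Real.sin θ + b.2 * Real.cos θ := by
      have h5 : (k.1 + b.1) * Real.sin θ + (k.2 + b.2) * Real.cos θ
          = x.1 * Real.sin θ + x.2 * Real.cos θ + r := by
        rw [h1, h2]
        linear_combination r * hsc
      linarith
    have h5 : (b.1 - r * Real.sin θ) ^ 2 + (b.2 - r * Real.cos θ) ^ 2 ≤ 0 := by
      have h6 := hb.1
      have h7 := mul_le_mul_of_nonneg_left h4 hr0.le
      have h8 : (b.1 - r * Real.sin θ) ^ 2 + (b.2 - r * Real.cos θ) ^ 2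
          = b.1 ^ 2 + b.2 ^ 2 + r ^ 2 - 2 * (r * (b.1 * Real.sin θ + b.2 * Real.cos θ)) := by
        linear_combination r ^ 2 * hsc
      rw [h8]
      linarith
    have hb1 : b.1 = r * Real.sin θ := by
      nlinarith [sq_nonneg (b.1 - r * Real.sin θ), sq_nonneg (b.2 - r * Real.cos θ)]
    have hb2 : b.2 = r * Real.cos θ := by
      nlinarith [sq_nonneg (b.1 - r * Real.sin θ), sq_nonneg (b.2 - r * Real.cos θ)]
    refine ⟨k.2, ?_, fun w hw => ?_⟩
    · rw [← hb1, ← hkb]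
      exact hk
    · have h6 : w.1 * Real.sin θ + w.2 * Real.cos θ ≤ x.1 * Real.sin θ + x.2 * Real.cos θ :=
        hmax hw
      have hx1 : x.1 = r * Real.sin θ := by linarith
      have hx2 : x.2 = k.2 := by linarith
      rw [hx1, hx2] at h6
      linarith
  choose! k hks hkmax using hkey
  have harc : ∀ θ ∈ Set.Ioo (-α) α, r * Real.cos θ - k θ = 0 := fun θ hθ => by
    refine eq_zero_of_sub_mul_cos_le (f := fun θ => r * Real.cos θ - k θ) hr0.le hα0 hα ?_ ?_ ?_ hθ
    · intro x hx
      have h1 := (hsD (hks x hx)).1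
      simp only at h1
      have h2 : k x ^ 2 ≤ (r * Real.cos x) ^ 2 := by
        have := Real.sin_sq_add_cos_sq x
        nlinarith
      have h3 := abs_le_of_sq_le_sq h2 (by have := hcospos x hx; positivity)
      linarith [(abs_le.1 h3).2]
    · intro x hx y hy
      have h1 := hkmax x hx _ (hks y hy)
      simp only at h1
      rw [Real.cos_sub]
      have h2 := Real.sin_sq_add_cos_sq x
      linear_combination h1 + r * h2
    · intro x hx
      have h1 := hkmax x hx _ hr
      simp only at h1
      rw [Real.cos_sub]
      have h2 := Real.sin_sq_add_cos_sq x
      linear_combination h1 + r * h2 + Real.sin x * hsin + Real.cos x * hcos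
  obtain ⟨x, y⟩ := z
  simp only at hz hzc
  have hx1 : |x| ≤ 1 := abs_fst_le_one_of_mem_diskSector hc (z := (x, y)) ⟨hz.le, hzc⟩
  have hy0 : 0 ≤ y := le_trans (by positivity) hzc
  rcases hx1.lt_or_eq with hx1 | hx1
  · have hx2 := abs_lt.1 hx1
    have hr1 : 1 ≤ r := by
      have := Real.sin_le_one α
      nlinarith
    have hsα : Real.sin α = 1 / r := by
      field_simp
      linarith
    have hθ : Real.arcsin (x / r) ∈ Set.Ioo (-α) α := by
      constructor
      · rw [Real.lt_arcsin_iff_sin_lt' ⟨by linarith, by linarith⟩, Real.sin_neg, hsα, ← neg_div]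
        · exact (div_lt_div_iff_of_pos_right hr0).2 hx2.1
      · rw [Real.arcsin_lt_iff_lt_sin' ⟨by linarith, hα⟩, hsα]
        exact (div_lt_div_iff_of_pos_right hr0).2 hx2.2
    have hs1 : r * Real.sin (Real.arcsin (x / r)) = x := by
      rw [Real.sin_arcsin]
      · field_simp
      · rw [le_div_iff₀ hr0]
        linarith
      · rw [div_le_one hr0]
        linarith
    have hc1 : r * Real.cos (Real.arcsin (x / r)) = y := by
      have h1 := Real.sin_sq_add_cos_sq (Real.arcsin (x / r))
      have h2 : (r * Real.cos (Real.arcsin (x / r))) ^ 2 = y ^ 2 := by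
        have h3 : (r * Real.sin (Real.arcsin (x / r))) ^ 2 = x ^ 2 := by rw [hs1]
        linear_combination r ^ 2 * h1 + hr2 - h3 - hz
      exact (pow_left_inj₀ (mul_nonneg hr0.le (Real.cos_arcsin_nonneg _)) hy0 two_ne_zero).1 h2
    have h1 := hks _ hθ
    have h2 := harc _ hθ
    rwa [hs1, ← sub_eq_zero.1 h2, hc1] at h1
  · have hyc : y = c := by
      have : y ^ 2 = c ^ 2 := by
        rw [← sq_abs x, hx1] at hz
        linarith
      exact (pow_left_inj₀ hy0 hc two_ne_zero).1 this
    rcases eq_or_eq_neg_of_abs_eq hx1 with rfl | rfl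
    · rwa [hyc]
    · rwa [hyc]

/-- The vector `e` and its rotation by a right angle give conformal linear coordinates. -/
theorem exists_conformal_frame {e : EuclideanSpace ℝ (Fin 2)} (he : e ≠ 0) :
    ∃ φ : (ℝ × ℝ) ≃L[ℝ] EuclideanSpace ℝ (Fin 2),
      (∀ z, φ z = z.1 • e + z.2 • !₂[-e 1, e 0]) ∧
      ∀ z, ‖φ z‖ ^ 2 = ‖e‖ ^ 2 * (z.1 ^ 2 + z.2 ^ 2) := by
  let f : (ℝ × ℝ) →ₗ[ℝ] EuclideanSpace ℝ (Fin 2) :=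
    (LinearMap.toSpanSingleton ℝ _ e).coprod (LinearMap.toSpanSingleton ℝ _ !₂[-e 1, e 0])
  have hf : ∀ z, f z = z.1 • e + z.2 • !₂[-e 1, e 0] := fun z => by
    simp [f]
  have hnorm : ∀ z, ‖f z‖ ^ 2 = ‖e‖ ^ 2 * (z.1 ^ 2 + z.2 ^ 2) := fun z => by
    rw [hf, EuclideanSpace.real_norm_sq_eq, EuclideanSpace.real_norm_sq_eq, Fin.sum_univ_two,
      Fin.sum_univ_two]
    simp
    ring
  have hinj : Function.Injective f := by
    rw [injective_iff_map_eq_zero]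
    intro z hz
    have h := hnorm z
    rw [hz, norm_zero, zero_pow two_ne_zero, eq_comm, mul_eq_zero] at h
    have he' : ‖e‖ ^ 2 ≠ 0 := by simpa using he
    have h' := h.resolve_left he'
    refine Prod.ext ?_ ?_
    · show z.1 = 0
      nlinarith [sq_nonneg z.1, sq_nonneg z.2]
    · show z.2 = 0
      nlinarith [sq_nonneg z.1, sq_nonneg z.2]
  refine ⟨(LinearMap.linearEquivOfInjective f hinj (by simp)).toContinuousLinearEquiv, ?_, ?_⟩
  · exact hf
  · exact hnorm

theorem exists_volume_image_eq_mul (φ : (ℝ × ℝ) ≃L[ℝ] EuclideanSpace ℝ (Fin 2)) :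
    ∃ κ : ENNReal, κ ≠ 0 ∧ κ ≠ ⊤ ∧ ∀ s : Set (ℝ × ℝ), volume (φ '' s) = κ * volume s := by
  let ν : Measure (ℝ × ℝ) := Measure.map φ.symm volume
  refine ⟨ν.addHaarScalarFactor volume, ?_, ENNReal.coe_ne_top, fun s => ?_⟩
  · exact_mod_cast (Measure.addHaarScalarFactor_pos_of_isAddHaarMeasure ν volume).ne'
  · have h : ν s = volume (φ '' s) := by
      have := φ.symm.toHomeomorph.toMeasurableEquiv.map_apply (μ := volume) s
      rw [φ.image_eq_preimage_symm]
      exact this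
    rw [← h]
    conv_lhs => rw [Measure.isAddLeftInvariant_eq_smul ν volume]
    rfl

/-- The Brunn–Minkowski type inequality for the parts of `K` and of the disc of radius `R` in `S`,
together with its equality case. -/
def SectorInequality (K : Set (EuclideanSpace ℝ (Fin 2))) (R : ℝ)
    (S : Set (EuclideanSpace ℝ (Fin 2))) : Prop :=
  2 * (volume (K ∩ S) + volume (closedBall 0 R ∩ S)) ≤ volume (K ∩ S + closedBall 0 R ∩ S) ∧
    (volume (K ∩ S + closedBall 0 R ∩ S) ≤ 2 * (volume (K ∩ S) + volume (closedBall 0 R ∩ S)) →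
      sphere 0 R ∩ S ⊆ K)

theorem sectorInequality_image {K : Set (EuclideanSpace ℝ (Fin 2))} (hK : IsCompact K)
    (hKc : Convex ℝ K) {R : ℝ} (hR : 0 ≤ R) (hKR : K ⊆ closedBall 0 R)
    (φ : (ℝ × ℝ) ≃L[ℝ] EuclideanSpace ℝ (Fin 2)) {a c : ℝ} (ha : 0 < a) (hc : 0 ≤ c)
    (hφ : ∀ z, ‖φ z‖ ^ 2 = a * (z.1 ^ 2 + z.2 ^ 2)) (hRc : R ^ 2 = a * (1 + c ^ 2))
    (hl : φ (-1, c) ∈ K) (hr : φ (1, c) ∈ K) :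
    SectorInequality K R (φ '' {z | c * |z.1| ≤ z.2}) := by
  have hball : ∀ z, φ z ∈ closedBall (0 : EuclideanSpace ℝ (Fin 2)) R ↔
      z.1 ^ 2 + z.2 ^ 2 ≤ 1 + c ^ 2 := fun z => by
    rw [mem_closedBall_zero_iff, ← pow_le_pow_iff_left₀ (norm_nonneg _) hR two_ne_zero, hφ, hRc,
      mul_le_mul_iff_right₀ ha]
  have hsphere : ∀ z, φ z ∈ sphere (0 : EuclideanSpace ℝ (Fin 2)) R →
      z.1 ^ 2 + z.2 ^ 2 = 1 + c ^ 2 := fun z hz => by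
    rw [mem_sphere_zero_iff_norm] at hz
    have h := hφ z
    rw [hz, hRc] at h
    exact (mul_left_cancel₀ ha.ne' h).symm
  set s : Set (ℝ × ℝ) := φ ⁻¹' K ∩ diskSector c with hs
  have hpre : IsCompact (φ ⁻¹' K) := φ.toHomeomorph.isCompact_preimage.2 hK
  have hs1 : IsCompact s := hpre.inter_right (isCompact_diskSector c).isClosed
  have hs2 : Convex ℝ s :=
    (hKc.linear_preimage φ.toLinearEquiv.toLinearMap).inter (convex_diskSector hc)
  have hs3 : s ⊆ diskSector c := Set.inter_subset_right
  have hs4 : (-1, c) ∈ s := ⟨hl, by constructor <;> simp⟩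
  have hs5 : (1, c) ∈ s := ⟨hr, by constructor <;> simp⟩
  have hKS : K ∩ φ '' {z | c * |z.1| ≤ z.2} = φ '' s := by
    ext x
    constructor
    · rintro ⟨hx, z, hz, rfl⟩
      exact ⟨z, ⟨hx, (hball z).1 (hKR hx), hz⟩, rfl⟩
    · rintro ⟨z, hz, rfl⟩
      exact ⟨hz.1, z, hz.2.2, rfl⟩
  have hBS : closedBall 0 R ∩ φ '' {z | c * |z.1| ≤ z.2} = φ '' diskSector c := by
    ext x
    constructor
    · rintro ⟨hx, z, hz, rfl⟩
      exact ⟨z, ⟨(hball z).1 hx, hz⟩, rfl⟩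
    · rintro ⟨z, hz, rfl⟩
      exact ⟨(hball z).2 hz.1, z, hz.2, rfl⟩
  obtain ⟨κ, hκ0, hκ, hvol⟩ := exists_volume_image_eq_mul φ
  rw [SectorInequality, hKS, hBS, ← Set.image_add, hvol, hvol, hvol, ← mul_add, mul_left_comm,
    ENNReal.mul_le_mul_iff_right hκ0 hκ, ENNReal.mul_le_mul_iff_right hκ0 hκ]
  refine ⟨(two_mul_volume_add_le_volume_fiberSum_diskSector hc hs1 hs2 hs3 hs4 hs5).trans
    (measure_mono (fiberSum_subset_add _ _)), fun h => ?_⟩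
  rintro _ ⟨hx, z, hz, rfl⟩
  exact (mem_of_add_diskSector_subset_fiberSum hc hs1 hs3 hs4 hs5
    (add_diskSector_subset_fiberSum hc hs1 hs2 hs3 hs4 hs5 h) (hsphere z hx) hz).1

/-- The convex cone spanned by two vectors. -/
def coneSpan (p q : EuclideanSpace ℝ (Fin 2)) : Set (EuclideanSpace ℝ (Fin 2)) :=
  {z | ∃ a b : ℝ, 0 ≤ a ∧ 0 ≤ b ∧ z = a • p + b • q}

theorem coneSpan_comm (p q : EuclideanSpace ℝ (Fin 2)) : coneSpan p q = coneSpan q p := by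
  ext z
  constructor <;> rintro ⟨a, b, ha, hb, rfl⟩ <;> exact ⟨b, a, hb, ha, add_comm _ _⟩

theorem coneSpan_add_subset (p q : EuclideanSpace ℝ (Fin 2)) :
    coneSpan p q + coneSpan p q ⊆ coneSpan p q := by
  rintro _ ⟨_, ⟨a, b, ha, hb, rfl⟩, _, ⟨a', b', ha', hb', rfl⟩, rfl⟩
  exact ⟨a + a', b + b', add_nonneg ha ha', add_nonneg hb hb', by module⟩

/-- The planar cross product. -/
def cross (p q : EuclideanSpace ℝ (Fin 2)) : ℝ := p 0 * q 1 - p 1 * q 0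

theorem eq_cross_smul_add {p q : EuclideanSpace ℝ (Fin 2)} (h : cross p q ≠ 0)
    (z : EuclideanSpace ℝ (Fin 2)) :
    z = (cross z q / cross p q) • p + (cross p z / cross p q) • q := by
  ext i
  fin_cases i <;> simp <;> field_simp <;> simp only [cross] <;> ring

theorem eq_zero_of_smul_add_smul_eq_zero {p q : EuclideanSpace ℝ (Fin 2)} (h : cross p q ≠ 0)
    {a b : ℝ} (hab : a • p + b • q = 0) : a = 0 := by
  have h0 : a * p 0 + b * q 0 = 0 := by simpa using congrArg (fun z => z 0) hab
  have h1 : a * p 1 + b * q 1 = 0 := by simpa using congrArg (fun z => z 1) hab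
  have h2 : a * cross p q = 0 := by
    rw [cross]
    linear_combination q 1 * h0 - q 0 * h1
  exact (mul_eq_zero.1 h2).resolve_right h

theorem cross_ne_zero {p q : EuclideanSpace ℝ (Fin 2)} (h : ‖p‖ = ‖q‖) (hpq : p ≠ q)
    (hpq' : p ≠ -q) : cross p q ≠ 0 := by
  intro hc
  rw [cross] at hc
  have h2 : ‖p‖ ^ 2 = ‖q‖ ^ 2 := by rw [h]
  rw [EuclideanSpace.real_norm_sq_eq, EuclideanSpace.real_norm_sq_eq, Fin.sum_univ_two,
    Fin.sum_univ_two] at h2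
  have h3 : ((p 0 - q 0) ^ 2 + (p 1 - q 1) ^ 2) * ((p 0 + q 0) ^ 2 + (p 1 + q 1) ^ 2) = 0 := by
    linear_combination (p 0 ^ 2 + p 1 ^ 2 - q 0 ^ 2 - q 1 ^ 2) * h2 +
      4 * (p 0 * q 1 - p 1 * q 0) * hc
  rcases mul_eq_zero.1 h3 with h4 | h4
  · refine hpq ?_
    ext i
    fin_cases i <;> simp <;>
      nlinarith [sq_nonneg (p 0 - q 0), sq_nonneg (p 1 - q 1)]
  · refine hpq' ?_
    ext i
    fin_cases i <;> simp <;>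
      nlinarith [sq_nonneg (p 0 + q 0), sq_nonneg (p 1 + q 1)]

theorem sectorInequality_coneSpan {K : Set (EuclideanSpace ℝ (Fin 2))} (hK : IsCompact K)
    (hKc : Convex ℝ K) {R : ℝ} (hR : 0 ≤ R) (hKR : K ⊆ closedBall 0 R)
    {p q : EuclideanSpace ℝ (Fin 2)} (hp : p ∈ K) (hq : q ∈ K) (hpR : ‖p‖ = R) (hqR : ‖q‖ = R)
    (hpq : p ≠ q) (hpq' : p ≠ -q) : SectorInequality K R (coneSpan p q) := by
  wlog hneg : cross p q < 0 generalizing p q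
  · rw [coneSpan_comm]
    refine this hq hp hqR hpR hpq.symm (fun h => hpq' (by rw [h, neg_neg])) ?_
    have h1 := cross_ne_zero (hpR.trans hqR.symm) hpq hpq'
    have h2 : cross q p = - cross p q := by
      rw [cross, cross]
      ring
    rw [h2, neg_lt_zero]
    exact lt_of_le_of_ne (not_lt.1 hneg) h1.symm
  obtain ⟨e, he⟩ : ∃ e, e = (1 / 2 : ℝ) • (q - p) := ⟨_, rfl⟩
  have he0 : e ≠ 0 := by
    rw [he]
    exact smul_ne_zero (by norm_num) (sub_ne_zero.2 hpq.symm)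
  obtain ⟨φ, hφ, hφn⟩ := exists_conformal_frame he0
  have hen : 0 < ‖e‖ ^ 2 := by positivity
  have hee : ‖e‖ ^ 2 = e 0 ^ 2 + e 1 ^ 2 := by
    rw [EuclideanSpace.real_norm_sq_eq, Fin.sum_univ_two]
  have he_0 : e 0 = (q 0 - p 0) / 2 := by
    rw [he]
    simp
    ring
  have he_1 : e 1 = (q 1 - p 1) / 2 := by
    rw [he]
    simp
    ring
  have hperp : (q 0 - p 0) * (q 0 + p 0) + (q 1 - p 1) * (q 1 + p 1) = 0 := by
    have h2 : ‖p‖ ^ 2 = ‖q‖ ^ 2 := by rw [hpR, hqR]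
    rw [EuclideanSpace.real_norm_sq_eq, EuclideanSpace.real_norm_sq_eq, Fin.sum_univ_two,
      Fin.sum_univ_two] at h2
    linear_combination -h2
  obtain ⟨c, hc⟩ : ∃ c : ℝ, c = -cross p q / 2 / ‖e‖ ^ 2 := ⟨_, rfl⟩
  have hc0 : 0 < c := by
    rw [hc]
    exact div_pos (by linarith) hen
  have hce : c * ‖e‖ ^ 2 = -cross p q / 2 := by
    rw [hc]
    field_simp
  rw [hee, he_0, he_1, cross] at hce
  have hmid : (1 / 2 : ℝ) • (p + q) = c • !₂[-e 1, e 0] := by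
    have hne : ((q 0 - p 0) / 2) ^ 2 + ((q 1 - p 1) / 2) ^ 2 ≠ 0 := by
      rw [← he_0, ← he_1, ← hee]
      exact hen.ne'
    ext i
    fin_cases i
    · simp [he_1]
      refine mul_left_cancel₀ hne ?_
      linear_combination (q 1 - p 1) / 2 * hce + (q 0 - p 0) / 8 * hperp
    · simp [he_0]
      refine mul_left_cancel₀ hne ?_
      linear_combination -(q 0 - p 0) / 2 * hce + (q 1 - p 1) / 8 * hperp
  have hpφ : φ (-1, c) = p := by
    rw [hφ]
    simp only
    rw [← hmid, he]
    module
  have hqφ : φ (1, c) = q := by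
    rw [hφ]
    simp only
    rw [← hmid, he]
    module
  have hcone : coneSpan p q = φ '' {z | c * |z.1| ≤ z.2} := by
    ext z
    constructor
    · rintro ⟨a, b, ha, hb, rfl⟩
      refine ⟨a • (-1, c) + b • (1, c), ?_, by rw [map_add, map_smul, map_smul, hpφ, hqφ]⟩
      have h1 : |-a + b| ≤ a + b := abs_le.2 ⟨by linarith, by linarith⟩
      have h2 := mul_le_mul_of_nonneg_left h1 hc0.le
      simp only [Set.mem_ofPred_eq, Prod.smul_mk, Prod.mk_add_mk, smul_eq_mul]
      rw [mul_neg_one, mul_one]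
      linarith
    · rintro ⟨⟨x, y⟩, hz, rfl⟩
      simp only [Set.mem_ofPred_eq] at hz
      have h1 : |x| ≤ y / c := by
        rw [le_div_iff₀ hc0]
        linarith
      have h2 := abs_le.1 h1
      refine ⟨(y / c - x) / 2, (y / c + x) / 2, by linarith, by linarith, ?_⟩
      rw [← hpφ, ← hqφ, ← map_smul, ← map_smul, ← map_add]
      congr 1
      simp only [Prod.smul_mk, Prod.mk_add_mk, smul_eq_mul, Prod.mk.injEq]
      constructor
      · ring
      · field_simp
        ring
  rw [hcone]
  refine sectorInequality_image hK hKc hR hKR φ hen hc0.le hφn ?_ (by rwa [hpφ]) (by rwa [hqφ])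
  have h := hφn (1, c)
  rwa [hqφ, hqR, one_pow] at h

theorem continuous_cross (p : EuclideanSpace ℝ (Fin 2)) : Continuous (cross p) := by
  unfold cross
  fun_prop

theorem continuous_cross_left (p : EuclideanSpace ℝ (Fin 2)) : Continuous fun z => cross z p := by
  unfold cross
  fun_prop

theorem volume_setOf_cross_eq_zero {p : EuclideanSpace ℝ (Fin 2)} (hp : p ≠ 0) :
    volume {z | cross p z = 0} = 0 := by
  obtain ⟨φ, hφ, -⟩ := exists_conformal_frame hp
  obtain ⟨κ, -, -, hvol⟩ := exists_volume_image_eq_mul φ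
  refine measure_mono_null (t := φ '' (Set.univ ×ˢ {0})) (fun z hz => ?_) ?_
  · obtain ⟨w, rfl⟩ := φ.surjective z
    refine ⟨w, ⟨Set.mem_univ _, ?_⟩, rfl⟩
    have hpp : 0 < ‖p‖ ^ 2 := by positivity
    rw [EuclideanSpace.real_norm_sq_eq, Fin.sum_univ_two] at hpp
    have h : w.2 * (p 0 ^ 2 + p 1 ^ 2) = 0 := by
      have hz' : cross p (φ w) = 0 := hz
      rw [hφ, cross] at hz'
      simp at hz'
      linear_combination hz'
    exact (mul_eq_zero.1 h).resolve_right hpp.ne'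
  · rw [hvol, Measure.volume_eq_prod, Measure.prod_prod]
    simp

theorem sectorInequality_halfPlane {K : Set (EuclideanSpace ℝ (Fin 2))} (hK : IsCompact K)
    (hKc : Convex ℝ K) {R : ℝ} (hR : 0 < R) (hKR : K ⊆ closedBall 0 R)
    {p : EuclideanSpace ℝ (Fin 2)} (hp : p ∈ K) (hp' : -p ∈ K) (hpR : ‖p‖ = R) :
    SectorInequality K R {z | 0 ≤ cross p z} := by
  have hp0 : p ≠ 0 := norm_pos_iff.1 (hpR ▸ hR)
  obtain ⟨φ, hφ, hφn⟩ := exists_conformal_frame hp0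
  have hpp : 0 < ‖p‖ ^ 2 := by positivity
  have hcross : ∀ z, cross p (φ z) = z.2 * ‖p‖ ^ 2 := fun z => by
    rw [hφ, cross, EuclideanSpace.real_norm_sq_eq, Fin.sum_univ_two]
    simp
    ring
  have hS : {z | 0 ≤ cross p z} = φ '' {z | 0 * |z.1| ≤ z.2} := by
    ext z
    obtain ⟨w, rfl⟩ := φ.surjective z
    rw [φ.injective.mem_set_image]
    simp only [Set.mem_ofPred_eq, hcross, zero_mul]
    exact mul_nonneg_iff_of_pos_right hpp
  rw [hS]
  refine sectorInequality_image hK hKc hR.le hKR φ hpp le_rfl hφn (by rw [hpR]; ring) ?_ ?_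
  · rw [hφ]
    simpa using hp'
  · rw [hφ]
    simpa using hp

theorem isClosed_coneSpan {p q : EuclideanSpace ℝ (Fin 2)} (h : cross p q ≠ 0) :
    IsClosed (coneSpan p q) := by
  have hcone : coneSpan p q =
      {z | 0 ≤ cross z q / cross p q} ∩ {z | 0 ≤ cross p z / cross p q} := by
    ext z
    constructor
    · rintro ⟨a, b, ha, hb, rfl⟩
      have h1 : cross (a • p + b • q) q / cross p q = a := by
        rw [div_eq_iff h]
        simp [cross]
        ring
      have h2 : cross p (a • p + b • q) / cross p q = b := by
        rw [div_eq_iff h]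
        simp [cross]
        ring
      exact ⟨ha.trans_eq h1.symm, hb.trans_eq h2.symm⟩
    · rintro ⟨h1, h2⟩
      exact ⟨_, _, h1, h2, eq_cross_smul_add h z⟩
  rw [hcone]
  exact (isClosed_le continuous_const ((continuous_cross_left q).div_const _)).inter
    (isClosed_le continuous_const ((continuous_cross p).div_const _))

/-- If sectors tile the plane and the total inequality is an equality, then `K` contains the
whole circle of radius `R`. -/
theorem sphere_subset_of_sectorInequality {ι : Type*} [Fintype ι]
    {K : Set (EuclideanSpace ℝ (Fin 2))} (hK : IsCompact K) {R : ℝ}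
    {S : ι → Set (EuclideanSpace ℝ (Fin 2))} (hcl : ∀ i, IsClosed (S i))
    (hcov : ∀ z, ∃ i, z ∈ S i) (hdisj : Pairwise (Function.onFun (AEDisjoint volume) S))
    (hadd : ∀ i, S i + S i ⊆ S i) (hS : ∀ i, SectorInequality K R (S i))
    (h : volume (K + closedBall 0 R) ≤
      2 * (volume K + volume (closedBall (0 : EuclideanSpace ℝ (Fin 2)) R))) :
    sphere 0 R ⊆ K := by
  classical
  have hB : IsCompact (closedBall (0 : EuclideanSpace ℝ (Fin 2)) R) := isCompact_closedBall _ _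
  have hcover : ∀ T : Set (EuclideanSpace ℝ (Fin 2)), volume T ≤ ∑ i, volume (T ∩ S i) :=
    fun T => by
    refine (measure_mono (fun z hz => ?_)).trans
      (measure_iUnion_fintype_le volume fun i => T ∩ S i)
    obtain ⟨i, hi⟩ := hcov z
    exact Set.mem_iUnion.2 ⟨i, hz, hi⟩
  have hsumc : ∀ i, IsCompact (K ∩ S i + closedBall 0 R ∩ S i) := fun i =>
    (hK.inter_right (hcl i)).add (hB.inter_right (hcl i))
  have hsumS : ∀ i, K ∩ S i + closedBall 0 R ∩ S i ⊆ S i := fun i =>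
    (Set.add_subset_add Set.inter_subset_right Set.inter_subset_right).trans (hadd i)
  have hle : ∑ i, volume (K ∩ S i + closedBall 0 R ∩ S i) ≤
      ∑ i, 2 * (volume (K ∩ S i) + volume (closedBall 0 R ∩ S i)) := by
    calc ∑ i, volume (K ∩ S i + closedBall 0 R ∩ S i)
        = volume (⋃ i, (K ∩ S i + closedBall 0 R ∩ S i)) := by
          rw [measure_iUnion₀ (fun i j hij => (hdisj hij).mono (hsumS i) (hsumS j))
            fun i => (hsumc i).measurableSet.nullMeasurableSet, tsum_fintype]
      _ ≤ volume (K + closedBall 0 R) := measure_mono (Set.iUnion_subset fun i =>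
          Set.add_subset_add Set.inter_subset_left Set.inter_subset_left)
      _ ≤ 2 * (volume K + volume (closedBall (0 : EuclideanSpace ℝ (Fin 2)) R)) := h
      _ ≤ 2 * (∑ i, volume (K ∩ S i) + ∑ i, volume (closedBall 0 R ∩ S i)) := by
          gcongr <;> exact hcover _
      _ = ∑ i, 2 * (volume (K ∩ S i) + volume (closedBall 0 R ∩ S i)) := by
          rw [← Finset.sum_add_distrib, Finset.mul_sum]
  intro z hz
  obtain ⟨i, hi⟩ := hcov z
  refine (hS i).2 ?_ ⟨hz, hi⟩
  rw [← Finset.add_sum_erase _ _ (Finset.mem_univ i),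
    ← Finset.add_sum_erase _ _ (Finset.mem_univ i)] at hle
  have hfin : ∑ j ∈ Finset.univ.erase i,
      2 * (volume (K ∩ S j) + volume (closedBall 0 R ∩ S j)) ≠ ⊤ := by
    refine ENNReal.sum_ne_top.2 fun j _ =>
      ENNReal.mul_ne_top (by simp) (ENNReal.add_ne_top.2 ⟨?_, ?_⟩)
    · exact (hK.inter_right (hcl j)).measure_lt_top.ne
    · exact (hB.inter_right (hcl j)).measure_lt_top.ne
  refine (ENNReal.add_le_add_iff_right hfin).1 (le_trans ?_ hle)
  gcongr with j hj
  exact (hS j).1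

theorem sphere_subset_of_antipodal {K : Set (EuclideanSpace ℝ (Fin 2))} (hK : IsCompact K)
    (hKc : Convex ℝ K) {R : ℝ} (hR : 0 < R) (hKR : K ⊆ closedBall 0 R)
    (h : volume (K + closedBall 0 R) ≤
      2 * (volume K + volume (closedBall (0 : EuclideanSpace ℝ (Fin 2)) R)))
    {p : EuclideanSpace ℝ (Fin 2)} (hp : p ∈ K) (hp' : -p ∈ K) (hpR : ‖p‖ = R) :
    sphere 0 R ⊆ K := by
  have hp0 : p ≠ 0 := norm_pos_iff.1 (hpR ▸ hR)
  have hneg : ∀ z, cross (-p) z = - cross p z := fun z => by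
    simp [cross]
    ring
  have hnull : AEDisjoint volume {z | 0 ≤ cross p z} {z | 0 ≤ cross (-p) z} := by
    refine measure_mono_null (fun z hz => ?_) (volume_setOf_cross_eq_zero hp0)
    have h1 : 0 ≤ cross p z := hz.1
    have h2 : 0 ≤ cross (-p) z := hz.2
    rw [hneg] at h2
    exact le_antisymm (by linarith) h1
  refine sphere_subset_of_sectorInequality hK
    (S := fun b : Bool => bif b then {z | 0 ≤ cross p z} else {z | 0 ≤ cross (-p) z})
    ?_ ?_ ?_ ?_ ?_ h
  · rintro (_ | _) <;> exact isClosed_le continuous_const (continuous_cross _)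
  · intro z
    rcases le_total 0 (cross p z) with hz | hz
    · exact ⟨true, hz⟩
    · refine ⟨false, ?_⟩
      show 0 ≤ cross (-p) z
      rw [hneg]
      linarith
  · rintro (_ | _) (_ | _) hij
    · exact absurd rfl hij
    · exact hnull.symm
    · exact hnull
    · exact absurd rfl hij
  · have hadd : ∀ q x y, cross q (x + y) = cross q x + cross q y := fun q x y => by
      simp [cross]
      ring
    rintro (_ | _) <;> rintro _ ⟨x, hx, y, hy, rfl⟩
    · exact (add_nonneg hx hy).trans_eq (hadd _ _ _).symm
    · exact (add_nonneg hx hy).trans_eq (hadd _ _ _).symm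
  · rintro (_ | _)
    · exact sectorInequality_halfPlane hK hKc hR hKR hp' (by rwa [neg_neg]) (by rwa [norm_neg])
    · exact sectorInequality_halfPlane hK hKc hR hKR hp hp' hpR

theorem cross_eq_zero_of_mem_coneSpan {p q r : EuclideanSpace ℝ (Fin 2)} {a b c : ℝ} (ha : 0 < a)
    (hc : 0 < c) (h : a • p + b • q + c • r = 0) (hpq : cross p q ≠ 0)
    {z : EuclideanSpace ℝ (Fin 2)} (hz : z ∈ coneSpan p q) (hz' : z ∈ coneSpan q r) :
    cross q z = 0 := by
  obtain ⟨x, y, hx, hy, rfl⟩ := hz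
  obtain ⟨x', y', hx', hy', hz⟩ := hz'
  have h1 : (c * x + y' * a) • p + (c * y - c * x' + y' * b) • q = 0 := by
    calc _ = c • (x • p + y • q) - c • (x' • q + y' • r) + y' • (a • p + b • q + c • r) := by
          module
      _ = 0 := by rw [hz, h, sub_self, smul_zero, zero_add]
  have h2 := eq_zero_of_smul_add_smul_eq_zero hpq h1
  have h3 : x = 0 := by
    have := mul_nonneg hc.le hx
    have := mul_nonneg hy' ha.le
    have h4 : c * x = 0 := by linarith
    exact (mul_eq_zero.1 h4).resolve_left hc.ne'
  rw [h3]
  simp [cross]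
  ring

theorem mem_coneSpan_of_smul_add_eq_zero {p q r : EuclideanSpace ℝ (Fin 2)} {a b c : ℝ}
    (ha : 0 < a) (hb : 0 < b) (hc : 0 < c) (h : a • p + b • q + c • r = 0) (hpq : cross p q ≠ 0)
    (z : EuclideanSpace ℝ (Fin 2)) : z ∈ coneSpan p q ∨ z ∈ coneSpan q r ∨ z ∈ coneSpan r p := by
  obtain ⟨x, y, hz⟩ : ∃ x y : ℝ, z = x • p + y • q := ⟨_, _, eq_cross_smul_add hpq z⟩
  have hz' : ∀ t : ℝ, z = (x - t * a) • p + (y - t * b) • q - (t * c) • r := fun t => by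
    calc z = x • p + y • q - t • (a • p + b • q + c • r) := by rw [h, smul_zero, sub_zero, hz]
      _ = _ := by module
  by_cases h1 : 0 ≤ x ∧ 0 ≤ y
  · exact Or.inl ⟨x, y, h1.1, h1.2, hz⟩
  rcases le_total (x / a) (y / b) with hxy | hxy
  · have hx : x / a ≤ 0 := by
      by_contra! hx
      exact h1 ⟨((div_pos_iff_of_pos_right ha).1 hx).le,
        ((div_pos_iff_of_pos_right hb).1 (hx.trans_le hxy)).le⟩
    refine Or.inr (Or.inl ⟨y - x / a * b, -(x / a * c), ?_, ?_, ?_⟩)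
    · rw [le_div_iff₀ hb] at hxy
      linarith
    · nlinarith
    · rw [hz' (x / a), div_mul_cancel₀ _ ha.ne']
      module
  · have hy : y / b ≤ 0 := by
      by_contra! hy
      exact h1 ⟨((div_pos_iff_of_pos_right ha).1 (hy.trans_le hxy)).le,
        ((div_pos_iff_of_pos_right hb).1 hy).le⟩
    refine Or.inr (Or.inr ⟨-(y / b * c), x - y / b * a, ?_, ?_, ?_⟩)
    · nlinarith
    · rw [le_div_iff₀ ha] at hxy
      linarith
    · rw [hz' (y / b), div_mul_cancel₀ _ hb.ne']
      module

theorem sphere_subset_of_triangle {K : Set (EuclideanSpace ℝ (Fin 2))} (hK : IsCompact K)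
    (hKc : Convex ℝ K) {R : ℝ} (hR : 0 < R) (hKR : K ⊆ closedBall 0 R)
    (h : volume (K + closedBall 0 R) ≤
      2 * (volume K + volume (closedBall (0 : EuclideanSpace ℝ (Fin 2)) R)))
    {p : Fin 3 → EuclideanSpace ℝ (Fin 2)} (hp : ∀ i, p i ∈ K) (hpR : ∀ i, ‖p i‖ = R)
    (hne : ∀ i j, i ≠ j → p i ≠ p j) (hne' : ∀ i j, p i ≠ -p j) {w : Fin 3 → ℝ}
    (hw : ∀ i, 0 < w i) (hwp : ∑ i, w i • p i = 0) : sphere 0 R ⊆ K := by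
  have hp0 : ∀ i, p i ≠ 0 := fun i => norm_pos_iff.1 (hpR i ▸ hR)
  have hcross : ∀ i j, i ≠ j → cross (p i) (p j) ≠ 0 := fun i j hij =>
    cross_ne_zero ((hpR i).trans (hpR j).symm) (hne i j hij) (hne' i j)
  rw [Fin.sum_univ_three] at hwp
  have hnext : ∀ i : Fin 3, i ≠ i + 1 := by decide
  have hwp' : ∀ i, w i • p i + w (i + 1) • p (i + 1) + w (i + 2) • p (i + 2) = 0 := by
    intro i
    rw [← hwp]
    fin_cases i <;> simp <;> abel
  have hnull : ∀ i : Fin 3, AEDisjoint volume (coneSpan (p i) (p (i + 1)))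
      (coneSpan (p (i + 1)) (p (i + 2))) := fun i =>
    measure_mono_null (fun z hz => cross_eq_zero_of_mem_coneSpan (hw i) (hw (i + 2)) (hwp' i)
      (hcross i (i + 1) (hnext i)) hz.1 hz.2) (volume_setOf_cross_eq_zero (hp0 (i + 1)))
  refine sphere_subset_of_sectorInequality hK
    (S := fun i : Fin 3 => coneSpan (p i) (p (i + 1))) ?_ ?_ ?_ ?_ ?_ h
  · exact fun i => isClosed_coneSpan (hcross i (i + 1) (hnext i))
  · intro z
    rcases mem_coneSpan_of_smul_add_eq_zero (hw 0) (hw 1) (hw 2) hwp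
      (hcross 0 1 (by decide)) z with hz | hz | hz
    exacts [⟨0, hz⟩, ⟨1, hz⟩, ⟨2, hz⟩]
  · intro i j hij
    have hcases : j = i + 1 ∨ i = j + 1 := by
      revert i j
      decide
    have htwo : ∀ i : Fin 3, i + 1 + 1 = i + 2 := by decide
    rcases hcases with rfl | rfl
    · have := hnull i
      rw [← htwo] at this
      exact this
    · have := (hnull j).symm
      rw [← htwo] at this
      exact this
  · exact fun i => coneSpan_add_subset _ _
  · exact fun i => sectorInequality_coneSpan hK hKc hR.le hKR (hp _) (hp _) (hpR _) (hpR _)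
      (hne _ _ (hnext i)) (hne' _ _)

/-- **Carathéodory's theorem** with a fixed number of points. -/
theorem mem_convexHull_iff_exists_fin {E : Type*} [AddCommGroup E] [Module ℝ E]
    [FiniteDimensional ℝ E] {s : Set E} {x : E} :
    x ∈ convexHull ℝ s ↔ ∃ (w : Fin (Module.finrank ℝ E + 1) → ℝ)
      (p : Fin (Module.finrank ℝ E + 1) → E), (∀ i, 0 ≤ w i) ∧ ∑ i, w i = 1 ∧ (∀ i, p i ∈ s) ∧
        ∑ i, w i • p i = x := by
  constructor
  · intro hx
    obtain ⟨ι, _, z, w, hz, haff, hw, hw1, hwz⟩ := eq_pos_convex_span_of_mem_convexHull hx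
    have hcard : Fintype.card ι ≤ Fintype.card (Fin (Module.finrank ℝ E + 1)) := by
      rw [Fintype.card_fin]
      exact haff.card_le_finrank_succ.trans
        (Nat.add_le_add_right (Submodule.finrank_le _) 1)
    obtain ⟨e⟩ := Function.Embedding.nonempty_of_card_le hcard
    have hne : Nonempty ι := by
      by_contra hne
      rw [not_nonempty_iff] at hne
      simp at hw1
    obtain ⟨i₀⟩ := hne
    have hw' : ∀ j ∉ Set.range e, Function.extend e w 0 j = 0 := fun j hj => by
      rw [Function.extend_apply' _ _ _ hj, Pi.zero_apply]
    refine ⟨Function.extend e w 0, Function.extend e z fun _ => z i₀, fun j => ?_, ?_, fun j => ?_,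
      ?_⟩
    · by_cases hj : j ∈ Set.range e
      · obtain ⟨i, rfl⟩ := hj
        rw [e.injective.extend_apply]
        exact (hw i).le
      · rw [hw' j hj]
    · rw [← hw1]
      exact (Fintype.sum_of_injective e e.injective _ _ hw'
        fun i => (e.injective.extend_apply _ _ i).symm).symm
    · by_cases hj : j ∈ Set.range e
      · obtain ⟨i, rfl⟩ := hj
        rw [e.injective.extend_apply]
        exact hz ⟨i, rfl⟩
      · rw [Function.extend_apply' _ _ _ hj]
        exact hz ⟨i₀, rfl⟩
    · rw [← hwz]
      refine (Fintype.sum_of_injective e e.injective _ _ (fun j hj => ?_) fun i => ?_).symm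
      · rw [hw' j hj, zero_smul]
      · rw [e.injective.extend_apply, e.injective.extend_apply]
  · rintro ⟨w, p, hw, hw1, hp, rfl⟩
    exact (convex_convexHull ℝ s).sum_mem (fun i _ => hw i) hw1
      fun i _ => subset_convexHull ℝ s (hp i)

theorem isCompact_convexHull {E : Type*} [NormedAddCommGroup E] [NormedSpace ℝ E]
    [FiniteDimensional ℝ E] {s : Set E} (hs : IsCompact s) : IsCompact (convexHull ℝ s) := by
  have himage : convexHull ℝ s = (fun y : (Fin (Module.finrank ℝ E + 1) → ℝ) ×
      (Fin (Module.finrank ℝ E + 1) → E) => ∑ i, y.1 i • y.2 i) ''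
      (stdSimplex ℝ (Fin (Module.finrank ℝ E + 1)) ×ˢ Set.pi Set.univ fun _ => s) := by
    ext x
    rw [mem_convexHull_iff_exists_fin]
    constructor
    · rintro ⟨w, p, hw, hw1, hp, rfl⟩
      exact ⟨(w, p), ⟨⟨hw, hw1⟩, fun i _ => hp i⟩, rfl⟩
    · rintro ⟨⟨w, p⟩, ⟨⟨hw, hw1⟩, hp⟩, rfl⟩
      exact ⟨w, p, hw, hw1, fun i => hp i (Set.mem_univ i), rfl⟩
  rw [himage]
  exact ((isCompact_stdSimplex ℝ _).prod (isCompact_univ_pi fun _ => hs)).image (by fun_prop)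

/-- If no ball centred away from the origin is a smaller enclosing ball, then the origin is in the
convex hull of the points of contact. -/
theorem zero_mem_convexHull_inter_sphere {E : Type*} [NormedAddCommGroup E] [InnerProductSpace ℝ E]
    [FiniteDimensional ℝ E] {K : Set E} (hK : IsCompact K) {R : ℝ} (hKR : K ⊆ closedBall 0 R)
    (hmin : ∀ x, ∃ k ∈ K, R ≤ dist k x) : (0 : E) ∈ convexHull ℝ (K ∩ sphere 0 R) := by
  by_contra h0
  obtain ⟨f, u, hu, hf⟩ := geometric_hahn_banach_point_closed (convex_convexHull ℝ _)
    (isCompact_convexHull (hK.inter_right isClosed_sphere)).isClosed h0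
  rw [map_zero] at hu
  obtain ⟨v, hv⟩ : ∃ v : E, ∀ y, f y = inner ℝ v y :=
    ⟨(InnerProductSpace.toDual ℝ E).symm f, fun y =>
      (InnerProductSpace.toDual_symm_apply (𝕜 := ℝ)).symm⟩
  choose k hkK hk using fun n : ℕ => hmin ((1 / ((n : ℝ) + 1)) • v)
  obtain ⟨y, hyK, φ, hφ, hlim⟩ := hK.tendsto_subseq hkK
  have hzero : Filter.Tendsto (fun n => 1 / ((φ n : ℝ) + 1)) Filter.atTop (nhds 0) :=
    tendsto_one_div_add_atTop_nhds_zero_nat.comp hφ.tendsto_atTop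
  have hy : y ∈ sphere (0 : E) R := by
    refine le_antisymm (hKR hyK) ?_
    have h1 : Filter.Tendsto (fun n => dist ((k ∘ φ) n) ((1 / ((φ n : ℝ) + 1)) • v)) Filter.atTop
        (nhds (dist y ((0 : ℝ) • v))) := hlim.dist (hzero.smul_const v)
    rw [zero_smul] at h1
    exact ge_of_tendsto' h1 fun n => hk (φ n)
  have hinner : inner ℝ v y ≤ 0 := by
    have h1 : Filter.Tendsto (fun n => inner ℝ v ((k ∘ φ) n)) Filter.atTop
        (nhds (inner ℝ v y)) := tendsto_const_nhds.inner hlim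
    have h2 : Filter.Tendsto (fun n => 1 / ((φ n : ℝ) + 1) * ‖v‖ ^ 2 / 2) Filter.atTop
        (nhds (0 * ‖v‖ ^ 2 / 2)) := (hzero.mul_const _).div_const _
    rw [zero_mul, zero_div] at h2
    refine le_of_tendsto_of_tendsto' h1 h2 fun n => ?_
    have ht : (0 : ℝ) < 1 / ((φ n : ℝ) + 1) := by positivity
    have h3 := hk (φ n)
    have h4 : ‖k (φ n)‖ ≤ R := mem_closedBall_zero_iff.1 (hKR (hkK (φ n)))
    rw [dist_eq_norm] at h3
    have h5 : ‖k (φ n)‖ ^ 2 ≤ ‖k (φ n) - (1 / ((φ n : ℝ) + 1)) • v‖ ^ 2 :=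
      pow_le_pow_left₀ (norm_nonneg _) (h4.trans h3) 2
    rw [norm_sub_sq_real, inner_smul_right, norm_smul, mul_pow, Real.norm_eq_abs, sq_abs,
      real_inner_comm] at h5
    have h6 : 1 / ((φ n : ℝ) + 1) * inner ℝ v (k (φ n)) ≤
        1 / ((φ n : ℝ) + 1) * (1 / ((φ n : ℝ) + 1) * ‖v‖ ^ 2 / 2) := by linarith
    exact le_of_mul_le_mul_left h6 ht
  have h7 := hf y (subset_convexHull ℝ _ ⟨hyK, hy⟩)
  rw [hv] at h7
  linarith

theorem eq_neg_of_smul_add_smul_eq_zero {E : Type*} [NormedAddCommGroup E] [NormedSpace ℝ E]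
    {p q : E} (hpq : ‖p‖ = ‖q‖) {a b : ℝ} (ha : 0 ≤ a) (hb : 0 ≤ b) (hab : a + b = 1)
    (h : a • p + b • q = 0) : p = -q := by
  have h1 : a • p = b • -q := by rw [smul_neg, eq_neg_of_add_eq_zero_left h]
  have h2 := congrArg norm h1
  rw [norm_smul, norm_smul, norm_neg, Real.norm_of_nonneg ha, Real.norm_of_nonneg hb, hpq] at h2
  rcases mul_eq_mul_right_iff.1 h2 with rfl | h3
  · have h4 : a ≠ 0 := by
      rintro rfl
      norm_num at hab
    exact (smul_right_injective E h4) h1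
  · rw [h3, norm_eq_zero] at hpq
    rw [norm_eq_zero] at h3
    rw [hpq, h3, neg_zero]

/-- If `K` contains enough points of contact with the circle of radius `R`, then equality in the
Brunn–Minkowski type inequality forces the whole circle to be contained in `K`. -/
theorem sphere_subset_of_zero_mem_convexHull {K : Set (EuclideanSpace ℝ (Fin 2))}
    (hK : IsCompact K) (hKc : Convex ℝ K) {R : ℝ} (hR : 0 < R) (hKR : K ⊆ closedBall 0 R)
    (h0 : (0 : EuclideanSpace ℝ (Fin 2)) ∈ convexHull ℝ (K ∩ sphere 0 R))
    (h : volume (K + closedBall 0 R) ≤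
      2 * (volume K + volume (closedBall (0 : EuclideanSpace ℝ (Fin 2)) R))) :
    sphere 0 R ⊆ K := by
  by_cases hanti : ∃ p ∈ K, -p ∈ K ∧ ‖p‖ = R
  · obtain ⟨p, hp, hp', hpR⟩ := hanti
    exact sphere_subset_of_antipodal hK hKc hR hKR h hp hp' hpR
  obtain ⟨w, p, hw, hw1, hp, hwp⟩ : ∃ (w : Fin 3 → ℝ) (p : Fin 3 → EuclideanSpace ℝ (Fin 2)),
      (∀ i, 0 ≤ w i) ∧ ∑ i, w i = 1 ∧ (∀ i, p i ∈ K ∩ sphere 0 R) ∧ ∑ i, w i • p i = 0 := by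
    have h1 := mem_convexHull_iff_exists_fin.1 h0
    rwa [finrank_euclideanSpace_fin] at h1
  have hpR : ∀ i, ‖p i‖ = R := fun i => mem_sphere_zero_iff_norm.1 (hp i).2
  have hne' : ∀ i j, p i ≠ -p j := fun i j hij =>
    hanti ⟨p j, (hp j).1, hij ▸ (hp i).1, hpR j⟩
  rw [Fin.sum_univ_three] at hw1
  have hwp' := hwp
  rw [Fin.sum_univ_three] at hwp
  have hw1' : ∀ i, w i + w (i + 1) + w (i + 2) = 1 := by
    intro i
    rw [← hw1]
    fin_cases i <;> simp <;> ring
  have hwp'' : ∀ i, w i • p i + w (i + 1) • p (i + 1) + w (i + 2) • p (i + 2) = 0 := by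
    intro i
    rw [← hwp]
    fin_cases i <;> simp <;> abel
  have hnext : ∀ i, p i ≠ p (i + 1) := by
    intro i hi
    refine hne' i (i + 2) (eq_neg_of_smul_add_smul_eq_zero ((hpR _).trans (hpR _).symm)
      (add_nonneg (hw i) (hw (i + 1))) (hw (i + 2)) (hw1' i) ?_)
    have h1 := hwp'' i
    rwa [← hi, ← add_smul] at h1
  refine sphere_subset_of_triangle hK hKc hR hKR h (fun i => (hp i).1) hpR ?_ hne'
    (fun i => (hw i).lt_of_ne' fun hi => ?_) hwp'
  · intro i j hij
    have hcases : j = i + 1 ∨ i = j + 1 := by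
      revert i j
      decide
    rcases hcases with rfl | rfl
    · exact hnext i
    · exact (hnext j).symm
  · refine hne' (i + 1) (i + 2) (eq_neg_of_smul_add_smul_eq_zero ((hpR _).trans (hpR _).symm)
      (hw (i + 1)) (hw (i + 2)) ?_ ?_)
    · have h1 := hw1' i
      rwa [hi, zero_add] at h1
    · have h1 := hwp'' i
      rwa [hi, zero_smul, zero_add] at h1

theorem exists_subset_closedBall_sInf {E : Type*} [PseudoMetricSpace E] [ProperSpace E] {K : Set E}
    (hK : IsCompact K) (hK0 : K.Nonempty) :
    ∃ x, K ⊆ closedBall x (sInf {r : ℝ | 0 ≤ r ∧ ∃ x, K ⊆ closedBall x r}) ∧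
      ∀ y, ∃ k ∈ K, sInf {r : ℝ | 0 ≤ r ∧ ∃ x, K ⊆ closedBall x r} ≤ dist k y := by
  obtain ⟨k₀, hk₀⟩ := hK0
  set T : Set ℝ := {r : ℝ | 0 ≤ r ∧ ∃ x, K ⊆ closedBall x r} with hT
  have hbdd : BddBelow T := ⟨0, fun r hr => hr.1⟩
  have hne : T.Nonempty := by
    obtain ⟨r, hr⟩ := hK.isBounded.subset_closedBall k₀
    exact ⟨r, dist_nonneg.trans (hr hk₀), k₀, hr⟩
  obtain ⟨r, hanti, hlim, hrT⟩ := exists_seq_tendsto_sInf hne hbdd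
  choose hr0 x hx using hrT
  have hx0 : ∀ n, x n ∈ closedBall k₀ (r 0) := fun n => by
    rw [mem_closedBall, dist_comm]
    exact (hx n hk₀).trans (hanti (Nat.zero_le n))
  obtain ⟨y, -, φ, hφ, hy⟩ := (isCompact_closedBall k₀ (r 0)).tendsto_subseq hx0
  refine ⟨y, fun k hk => ?_, fun z => ?_⟩
  · exact le_of_tendsto_of_tendsto' (tendsto_const_nhds.dist hy) (hlim.comp hφ.tendsto_atTop)
      fun n => hx (φ n) hk
  · obtain ⟨k, hk, hmax⟩ := hK.exists_isMaxOn ⟨k₀, hk₀⟩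
      (f := fun k => dist k z) (by fun_prop)
    exact ⟨k, hk, csInf_le hbdd ⟨dist_nonneg, z, fun k' hk' => hmax hk'⟩⟩

theorem eq_closedBall_of_volume_add_le {K : Set (EuclideanSpace ℝ (Fin 2))}
    (hK : IsCompact K) (hKc : Convex ℝ K) {R : ℝ} (hR : 0 < R) {x : EuclideanSpace ℝ (Fin 2)}
    (hKR : K ⊆ closedBall x R) (hmin : ∀ y, ∃ k ∈ K, R ≤ dist k y)
    (h : volume (K + closedBall 0 R) ≤
      2 * (volume K + volume (closedBall (0 : EuclideanSpace ℝ (Fin 2)) R))) :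
    K = closedBall x R := by
  have hsub : -x +ᵥ K ⊆ closedBall 0 R := by
    rintro _ ⟨k, hk, rfl⟩
    have h1 := hKR hk
    rw [mem_closedBall, dist_eq_norm] at h1
    simpa [neg_add_eq_sub] using h1
  have h0 : (0 : EuclideanSpace ℝ (Fin 2)) ∈ convexHull ℝ ((-x +ᵥ K) ∩ sphere 0 R) := by
    refine zero_mem_convexHull_inter_sphere (hK.vadd _) hsub fun y => ?_
    obtain ⟨k, hk, hky⟩ := hmin (x + y)
    refine ⟨-x +ᵥ k, Set.vadd_mem_vadd_set hk, hky.trans_eq ?_⟩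
    rw [dist_eq_norm, dist_eq_norm, vadd_eq_add]
    congr 1
    abel
  have hsphere := sphere_subset_of_zero_mem_convexHull (hK.vadd _) (hKc.vadd _) hR hsub h0
    (by rwa [vadd_add_assoc, measure_vadd, measure_vadd])
  have hball : closedBall 0 R ⊆ -x +ᵥ K := by
    rw [← convexHull_sphere_eq_closedBall _ hR.le]
    exact convexHull_min hsphere (hKc.vadd _)
  refine hKR.antisymm fun z hz => ?_
  have h1 : -x + z ∈ closedBall (0 : EuclideanSpace ℝ (Fin 2)) R := by
    rw [mem_closedBall, dist_eq_norm] at hz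
    simpa [neg_add_eq_sub] using hz
  obtain ⟨k, hk, hkz⟩ := hball h1
  exact add_left_cancel hkz ▸ hk

/-- **Bonnesen-style circumradius bound.** For a planar convex body `K` with nonempty
interior which is not a disc, the Steiner polynomial `A + L t + π t²` is strictly
negative at `t = -R_e`, where `R_e` is the circumradius (outradius) of `K`. -/
theorem planar_steiner_neg_at_circumradius (K : Set (EuclideanSpace ℝ (Fin 2)))
    (hKne : K.Nonempty) (hKcomp : IsCompact K) (hKconv : Convex ℝ K)
    (hKint : (interior K).Nonempty)
    (hKnotdisc : ¬ ∃ (x : EuclideanSpace ℝ (Fin 2)) (r : ℝ), K = closedBall x r)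
    (L : ℝ)
    (hL : ∀ t : ℝ, 0 ≤ t →
      (volume (K + t • closedBall (0 : EuclideanSpace ℝ (Fin 2)) 1)).toReal
        = (volume K).toReal + L * t + Real.pi * t ^ 2)
    (Re : ℝ)
    (hRe : Re = sInf {r : ℝ | 0 ≤ r ∧ ∃ x : EuclideanSpace ℝ (Fin 2), K ⊆ closedBall x r}) :
    (volume K).toReal - L * Re + Real.pi * Re ^ 2 < 0 := by
  obtain ⟨x, hx, hmin⟩ := exists_subset_closedBall_sInf hKcomp hKne
  rw [← hRe] at hx hmin
  have hR : 0 < Re := by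
    have hvol := (isOpen_interior.measure_pos volume hKint).trans_le
      (measure_mono (interior_subset.trans hx))
    rw [EuclideanSpace.volume_closedBall_fin_two] at hvol
    by_contra! hR
    simp [ENNReal.ofReal_of_nonpos hR] at hvol
  by_contra! hneg
  refine hKnotdisc ⟨x, Re, eq_closedBall_of_volume_add_le hKcomp hKconv hR hx hmin ?_⟩
  have hsteiner := hL Re hR.le
  rw [smul_unitClosedBall_of_nonneg hR.le] at hsteiner
  have hball : (volume (closedBall (0 : EuclideanSpace ℝ (Fin 2)) Re)).toReal
      = Real.pi * Re ^ 2 := by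
    rw [EuclideanSpace.volume_closedBall_fin_two]
    simp [ENNReal.toReal_ofReal hR.le, mul_comm, Real.pi_nonneg]
  have hcB : IsCompact (closedBall (0 : EuclideanSpace ℝ (Fin 2)) Re) := isCompact_closedBall _ _
  have hfinK := hKcomp.measure_lt_top (μ := volume).ne
  have hfinB := hcB.measure_lt_top (μ := volume).ne
  rw [← ENNReal.toReal_le_toReal (hKcomp.add hcB).measure_lt_top.ne
    (ENNReal.mul_ne_top (by simp) (ENNReal.add_ne_top.2 ⟨hfinK, hfinB⟩)), ENNReal.toReal_mul,
    ENNReal.toReal_add hfinK hfinB, hsteiner, hball, ENNReal.toReal_ofNat]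
  linarith
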